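/- Let T be a tree (a finite connected acyclic simple graph). Then for every vertex v of T, f_d(T, v) ≥ diam(T) + 1. -/

import Mathlib

open SimpleGraph

variable {V : Type*}

/-- The eccentricity of a vertex: the maximum graph distance to any vertex. -/
noncomputable def ecc [Fintype V] (G : SimpleGraph V) (u : V) : ℕ :=
  Finset.univ.sup fun w => G.dist u w

/-- The diameter of a graph: the maximum eccentricity. -/
noncomputable def graphDiam [Fintype V] (G : SimpleGraph V) : ℕ :=
  Finset.univ.sup fun u => ecc G u

/-- A nonempty set `U` of vertices is closed if for every `u ∈ U` and every vertex `v`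
there is `x ∈ U` with `dist u v = dist u x`. -/
def IsClosedSet (G : SimpleGraph V) (U : Set V) : Prop :=
  U.Nonempty ∧ ∀ u ∈ U, ∀ v : V, ∃ x ∈ U, G.dist u v = G.dist u x

/-- An Explorer strategy (assigning a called distance to each history, most recent
vertex first) is valid if, whenever the current vertex `u` has a legal call available
(`1 ≤ ecc u`), it calls some `k` with `1 ≤ k ≤ ecc u`. -/
def EValid [Fintype V] (G : SimpleGraph V) (ES : List V → ℕ) : Prop :=
  ∀ h : List V, ∀ u : V, h.head? = some u → 1 ≤ ecc G u →
    1 ≤ ES h ∧ ES h ≤ ecc G u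

/-- A Director strategy is valid if, for each history with current vertex `u` and each
legal called distance `k` (`1 ≤ k ≤ ecc u`), it answers a vertex at distance exactly `k`. -/
def DValid [Fintype V] (G : SimpleGraph V) (DS : List V → ℕ → V) : Prop :=
  ∀ h : List V, ∀ u : V, h.head? = some u → ∀ k : ℕ, 1 ≤ k → k ≤ ecc G u →
    G.dist u (DS h k) = k

/-- The history (most recent vertex first) of the first `n` moves of the play determined
by Explorer strategy `ES` and Director strategy `DS`, starting at `v`. -/
def play (ES : List V → ℕ) (DS : List V → ℕ → V) (v : V) : ℕ → List V
  | 0 => [v]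
  | n + 1 => DS (play ES DS v n) (ES (play ES DS v n)) :: play ES DS v n

/-- The number of distinct vertices visited in the play determined by `ES` and `DS`
starting at `v`. -/
noncomputable def playScore (ES : List V → ℕ) (DS : List V → ℕ → V) (v : V) : ℕ :=
  Set.ncard {x : V | ∃ n : ℕ, x ∈ play ES DS v n}

/-- `fd G v` : the max over valid Explorer strategies of the min over valid Director
strategies of the number of distinct vertices visited. -/
noncomputable def fd [Fintype V] (G : SimpleGraph V) (v : V) : ℕ :=
  sSup {r : ℕ | ∃ ES : List V → ℕ, EValid G ES ∧
    r = sInf {s : ℕ | ∃ DS : List V → ℕ → V, DValid G DS ∧ s = playScore ES DS v}}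

/-- A play `x` is consistent with the nonadaptive strategy `S` from start `v` if it starts
at `v` and each step has the prescribed length. -/
def NAConsistent (G : SimpleGraph V) (S : List ℕ) (v : V) (x : ℕ → V) : Prop :=
  x 0 = v ∧ ∀ i < S.length, G.dist (x i) (x (i + 1)) = S.getD i 0

/-- A nonadaptive strategy is playable from `v` if every consistent initial segment
can be extended. -/
def NAPlayable (G : SimpleGraph V) (S : List ℕ) (v : V) : Prop :=
  ∀ x : ℕ → V, ∀ i < S.length, x 0 = v →
    (∀ j < i, G.dist (x j) (x (j + 1)) = S.getD j 0) →
    ∃ y : V, G.dist (x i) y = S.getD i 0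

/-- The score of a nonadaptive strategy `S` from `v`: the minimum over consistent plays
of the number of distinct vertices among `x 0, …, x S.length`. -/
noncomputable def naScore (G : SimpleGraph V) (S : List ℕ) (v : V) : ℕ :=
  sInf {k : ℕ | ∃ x : ℕ → V, NAConsistent G S v x ∧
    k = Set.ncard {w : V | ∃ i ≤ S.length, x i = w}}

/-- The `n × m` grid graph: the box product of two path graphs. -/
def gridGraph (n m : ℕ) : SimpleGraph (Fin n × Fin m) :=
  (pathGraph n) □ (pathGraph m)

section TreeMetric

/-- In a forest, every path is a geodesic. -/
theorem SimpleGraph.IsAcyclic.dist_eq_length {G : SimpleGraph V} (ha : G.IsAcyclic) {a b : V}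
    (p : G.Walk a b) (hp : p.IsPath) : G.dist a b = p.length := by
  obtain ⟨q, hq, hql⟩ := p.reachable.exists_path_of_dist
  have := ha.subsingleton_path a b
  have h : (⟨p, hp⟩ : G.Path a b) = ⟨q, hq⟩ := Subsingleton.elim _ _
  rw [← hql, Subtype.mk.inj h]

/-- A vertex on a geodesic splits the distance between its ends. -/
theorem SimpleGraph.Connected.dist_add_dist_of_mem_support {G : SimpleGraph V}
    (hc : G.Connected) {a b z : V} (p : G.Walk a b) (hp : p.length = G.dist a b)
    (hz : z ∈ p.support) : G.dist a z + G.dist z b = G.dist a b := by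
  classical
  have h := congrArg Walk.length (p.take_spec hz)
  rw [Walk.length_append] at h
  have h₁ := dist_le (p.takeUntil z hz)
  have h₂ := dist_le (p.dropUntil z hz)
  have := hc.dist_triangle (u := a) (v := z) (w := b)
  omega

/-- In a tree, the geodesic between vertices on different sides of an edge uses that edge. -/
theorem SimpleGraph.IsTree.dist_eq_of_adj_separating {G : SimpleGraph V} (ht : G.IsTree)
    {u u' x y : V} (h : G.Adj u' u) (hx : G.dist x u = G.dist x u' + 1)
    (hy : G.dist y u' = G.dist y u + 1) :
    G.dist x y = G.dist x u' + 1 + G.dist y u := by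
  have hc := ht.connected
  obtain ⟨p, hp, hpl⟩ := hc.exists_path_of_dist x u'
  obtain ⟨q, hq, hql⟩ := hc.exists_path_of_dist u y
  have hr : (p.append (Walk.cons h q)).IsPath := by
    rw [Walk.isPath_def, Walk.support_append, Walk.support_cons, List.tail_cons,
      List.nodup_append']
    refine ⟨hp.support_nodup, hq.support_nodup, fun z hz hz' => ?_⟩
    have h₁ := hc.dist_add_dist_of_mem_support p hpl hz
    have h₂ := hc.dist_add_dist_of_mem_support q hql hz'
    have h₃ := hc.dist_triangle (u := x) (v := z) (w := u)
    have h₄ := hc.dist_triangle (u := y) (v := z) (w := u')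
    rw [dist_comm (u := u), dist_comm (u := z) (v := y), dist_comm (u := u)] at h₂
    omega
  rw [ht.isAcyclic.dist_eq_length _ hr, Walk.length_append, Walk.length_cons, hpl, hql,
    dist_comm (u := u)]
  omega

/-- The four-point condition for trees. -/
theorem SimpleGraph.IsTree.four_point {G : SimpleGraph V} (ht : G.IsTree) (u w a b : V) :
    G.dist u w + G.dist a b ≤
      max (G.dist u a + G.dist w b) (G.dist u b + G.dist w a) := by
  obtain ⟨p⟩ := ht.connected.preconnected u a
  induction p with
  | nil =>
    rename_i u
    rw [dist_comm (u := w) (v := u)]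
    omega
  | @cons u u' a h p ih =>
    have key := fun {x y} => ht.dist_eq_of_adj_separating (x := x) (y := y) h
    have key' := fun {x y} => ht.dist_eq_of_adj_separating (x := x) (y := y) h.symm
    simp only [dist_comm (v := u), dist_comm (v := u')] at key key'
    rw [dist_comm (u := w) (v := a)] at ih ⊢
    have hab := key (x := a) (y := b)
    have haw := key (x := a) (y := w)
    have hwb := key (x := w) (y := b)
    have hab' := key' (x := a) (y := b)
    have haw' := key' (x := a) (y := w)
    have hwb' := key' (x := w) (y := b)
    have ha := ht.dist_eq_dist_add_one_of_adj a h
    have hb := ht.dist_eq_dist_add_one_of_adj b h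
    have hw := ht.dist_eq_dist_add_one_of_adj w h
    simp only [dist_comm (v := u), dist_comm (v := u')] at ha hb hw
    clear key key'
    have htri := ht.connected.dist_triangle (u := a) (v := u) (w := b)
    rw [dist_comm (v := u)] at htri
    rcases ha with ha | ha <;> rcases hb with hb | hb <;> rcases hw with hw | hw <;>
      simp only [ha, hb, hw, forall_const] at * <;> omega

end TreeMetric

section ClosedSets

variable [Fintype V]

theorem dist_le_ecc (G : SimpleGraph V) (u w : V) : G.dist u w ≤ ecc G u :=
  Finset.le_sup (f := fun w => G.dist u w) (Finset.mem_univ w)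

theorem exists_dist_eq_ecc (G : SimpleGraph V) (u : V) : ∃ w, G.dist u w = ecc G u := by
  obtain ⟨w, -, hw⟩ := Finset.exists_mem_eq_sup Finset.univ ⟨u, Finset.mem_univ u⟩
    (fun w => G.dist u w)
  exact ⟨w, hw.symm⟩

/-- All distances up to the eccentricity are realized. -/
theorem exists_dist_eq_of_le_ecc {G : SimpleGraph V} (hc : G.Connected) {u : V} {k : ℕ}
    (hk : k ≤ ecc G u) : ∃ w, G.dist u w = k := by
  obtain ⟨w, hw⟩ := exists_dist_eq_ecc G u
  obtain ⟨p, hp, hpl⟩ := hc.exists_path_of_dist u w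
  refine ⟨p.getVert k, ?_⟩
  have h := hc.dist_add_dist_of_mem_support p hpl (p.getVert_mem_support k)
  have h₁ := dist_le (p.take k)
  have h₂ := dist_le (p.drop k)
  rw [Walk.take_length] at h₁
  rw [Walk.drop_length] at h₂
  omega

/-- In a tree, a vertex farthest from some vertex has eccentricity equal to the diameter. -/
theorem graphDiam_le_ecc_of_dist_eq_ecc {G : SimpleGraph V} (ht : G.IsTree) {u w : V}
    (hw : G.dist u w = ecc G u) : graphDiam G ≤ ecc G w := by
  refine Finset.sup_le fun a _ => ?_
  obtain ⟨b, hb⟩ := exists_dist_eq_ecc G a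
  have h := ht.four_point u w a b
  have h₁ := dist_le_ecc G u a
  have h₂ := dist_le_ecc G u b
  have h₃ := dist_le_ecc G w a
  have h₄ := dist_le_ecc G w b
  omega

/-- Every closed set of a tree has more vertices than the diameter. -/
theorem IsClosedSet.graphDiam_lt_ncard {G : SimpleGraph V} (ht : G.IsTree) {U : Set V}
    (hU : IsClosedSet G U) : graphDiam G + 1 ≤ U.ncard := by
  obtain ⟨⟨u, hu⟩, hcl⟩ := hU
  obtain ⟨w, hw⟩ := exists_dist_eq_ecc G u
  obtain ⟨x, hxU, hx⟩ := hcl u hu w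
  have hd := graphDiam_le_ecc_of_dist_eq_ecc ht (hx.symm.trans hw)
  have hsub : (Finset.range (graphDiam G + 1) : Set ℕ) ⊆ (fun y => G.dist x y) '' U := by
    intro k hk
    obtain ⟨z, hz⟩ := exists_dist_eq_of_le_ecc ht.connected (u := x) (k := k)
      (by simp at hk; omega)
    obtain ⟨y, hyU, hy⟩ := hcl x hxU z
    exact ⟨y, hyU, hy.symm.trans hz⟩
  have h := Set.ncard_le_ncard hsub (Set.toFinite _)
  rw [Set.ncard_coe_finset, Finset.card_range] at h
  exact h.trans (Set.ncard_image_le (Set.toFinite _))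

end ClosedSets

section CyclingExplorer

open Filter

/-- The current position after `n` moves. -/
def position (ES : List V → ℕ) (DS : List V → ℕ → V) (v : V) : ℕ → V
  | 0 => v
  | n + 1 => DS (play ES DS v n) (ES (play ES DS v n))

theorem play_eq_position_cons (ES : List V → ℕ) (DS : List V → ℕ → V) (v : V) (n : ℕ) :
    play ES DS v n = position ES DS v n :: (play ES DS v n).tail := by
  cases n <;> rfl

variable [DecidableEq V]

/-- A vertex visited infinitely often is visited for the `c`-th time, for every `c`. -/
theorem exists_count_tail_eq (ES : List V → ℕ) (DS : List V → ℕ → V) (v u : V)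
    (hu : ∃ᶠ n in atTop, position ES DS v n = u) (c : ℕ) :
    ∃ n, position ES DS v n = u ∧ (play ES DS v n).tail.count u = c := by
  have hmono : Monotone fun n => (play ES DS v n).count u :=
    monotone_nat_of_le_succ fun n => List.count_le_count_cons
  have hunb : ∃ n, c < (play ES DS v n).count u := by
    induction c with
    | zero =>
      obtain ⟨n, rfl⟩ := hu.exists
      exact ⟨n, by rw [play_eq_position_cons]; simp⟩
    | succ c ih =>
      obtain ⟨n, hn⟩ := ih
      obtain ⟨m, hm, hmu⟩ := frequently_atTop.1 hu (n + 1)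
      obtain ⟨m, rfl⟩ := Nat.exists_eq_add_of_le' (le_trans (Nat.le_add_left 1 n) hm)
      refine ⟨m + 1, ?_⟩
      have := hmono (show n ≤ m by omega)
      rw [play_eq_position_cons, hmu, List.count_cons_self]
      change _ < (play ES DS v m).count u + 1
      simp only at this
      omega
  classical
  obtain ⟨hn, hmin⟩ := Nat.find_spec hunb, fun m => @Nat.find_min _ _ hunb m
  generalize Nat.find hunb = n at hn hmin
  have htail : (play ES DS v n).tail.count u ≤ c := by
    cases n with
    | zero => simp [play]
    | succ m => exact not_lt.1 (hmin m m.lt_succ_self)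
  rw [play_eq_position_cons, List.count_cons] at hn
  refine ⟨n, ?_, ?_⟩ <;> split_ifs at hn with h <;> simp_all <;> omega

variable [Fintype V]

/-- The Explorer strategy that, at each vertex, cycles through all legal calls. -/
noncomputable def cyclingExplorer (G : SimpleGraph V) : List V → ℕ
  | [] => 0
  | u :: t => t.count u % ecc G u + 1

theorem cyclingExplorer_valid (G : SimpleGraph V) : EValid G (cyclingExplorer G) := by
  rintro (_ | ⟨w, t⟩) u h hu
  · simp at h
  · obtain rfl : w = u := by simpa using h
    have := Nat.mod_lt (t.count w) hu
    simp only [cyclingExplorer]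
    omega

/-- Against the cycling Explorer, the vertices visited infinitely often form a closed set. -/
theorem isClosedSet_setOf_frequently (G : SimpleGraph V) {DS : List V → ℕ → V}
    (hDS : DValid G DS) (v : V) :
    IsClosedSet G {u | ∃ᶠ n in atTop, position (cyclingExplorer G) DS v n = u} := by
  refine ⟨?_, fun u hu w => ?_⟩
  · exact frequently_exists.1 (Frequently.of_forall fun n => ⟨_, rfl⟩)
  · rcases Nat.eq_zero_or_pos (G.dist u w) with h0 | hpos
    · exact ⟨u, hu, by simp [h0]⟩
    have hle := dist_le_ecc G u w
    have hcall : ∃ᶠ n in atTop, position (cyclingExplorer G) DS v n = u ∧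
        cyclingExplorer G (play (cyclingExplorer G) DS v n) = G.dist u w := by
      choose f hfu hfc using exists_count_tail_eq (cyclingExplorer G) DS v u hu
      let g : ℕ → ℕ := fun j => f (ecc G u * j + (G.dist u w - 1))
      have hg : Function.Injective g := by
        intro i j hij
        have h := (hfc _).symm.trans ((congrArg
          (fun n => (play (cyclingExplorer G) DS v n).tail.count u) hij).trans (hfc _))
        exact Nat.eq_of_mul_eq_mul_left (by omega : 0 < ecc G u) (by omega)
      refine hg.nat_tendsto_atTop.frequently (Frequently.of_forall fun j => ⟨hfu _, ?_⟩)
      rw [play_eq_position_cons, hfu]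
      simp only [cyclingExplorer, g, hfc]
      rw [Nat.mul_add_mod, Nat.mod_eq_of_lt (by omega)]
      omega
    have hnext : ∃ᶠ n in atTop, ∃ x, position (cyclingExplorer G) DS v (n + 1) = x ∧
        G.dist u w = G.dist u x := by
      refine hcall.mono fun n ⟨hn, hk⟩ => ⟨_, rfl, ?_⟩
      have hhead : (play (cyclingExplorer G) DS v n).head? = some u := by
        rw [play_eq_position_cons, hn, List.head?_cons]
      rw [position, hk]
      exact (hDS _ u hhead _ hpos hle).symm
    obtain ⟨x, hx⟩ := frequently_exists.1 hnext
    obtain ⟨_, -, hdx⟩ := hx.exists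
    exact ⟨x, (tendsto_add_atTop_nat 1).frequently (hx.mono fun _ h => h.1), hdx⟩

end CyclingExplorer

section Value

variable [Fintype V]

theorem exists_dValid {G : SimpleGraph V} (hc : G.Connected) :
    ∃ DS : List V → ℕ → V, DValid G DS := by
  classical
  have h : ∀ u k, ∃ x, k ≤ ecc G u → G.dist u x = k := fun u k => by
    by_cases hk : k ≤ ecc G u
    · obtain ⟨x, hx⟩ := exists_dist_eq_of_le_ecc hc hk
      exact ⟨x, fun _ => hx⟩
    · exact ⟨u, fun h => absurd h hk⟩
  choose f hf using h
  obtain ⟨v₀⟩ := hc.nonempty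
  refine ⟨fun h k => f (h.head?.getD v₀) k, fun h u hu k _ hk => ?_⟩
  simpa [hu] using hf u k hk

theorem playScore_le_card (ES : List V → ℕ) (DS : List V → ℕ → V) (v : V) :
    playScore ES DS v ≤ Nat.card V := by
  rw [playScore, ← Set.ncard_univ]
  exact Set.ncard_le_ncard (Set.subset_univ _) (Set.toFinite _)

/-- An Explorer strategy guaranteeing `m` vertices bounds the value of the game below. -/
theorem le_fd_of_forall_le_playScore {G : SimpleGraph V} (hc : G.Connected) {v : V} {m : ℕ}
    {ES : List V → ℕ} (hES : EValid G ES)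
    (h : ∀ DS, DValid G DS → m ≤ playScore ES DS v) : m ≤ fd G v := by
  obtain ⟨D, hD⟩ := exists_dValid hc
  have hbdd : BddAbove {r : ℕ | ∃ ES : List V → ℕ, EValid G ES ∧
      r = sInf {s : ℕ | ∃ DS : List V → ℕ → V, DValid G DS ∧ s = playScore ES DS v}} := by
    refine ⟨Nat.card V, ?_⟩
    rintro r ⟨ES', -, rfl⟩
    refine le_trans (Nat.sInf_le ?_) (playScore_le_card ES' D v)
    exact ⟨D, hD, rfl⟩
  refine le_trans ?_ (le_csSup hbdd ⟨ES, hES, rfl⟩)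
  refine le_csInf ⟨_, D, hD, rfl⟩ ?_
  rintro s ⟨DS, hDS, rfl⟩
  exact h DS hDS

end Value

/-- For every tree `T` and every vertex `v`, `f_d(T, v) ≥ diam(T) + 1`. -/
theorem stmt_10 {V : Type*} [Fintype V] (G : SimpleGraph V)
    (hc : G.Connected) (ha : G.IsAcyclic) (v : V) :
    graphDiam G + 1 ≤ fd G v := by
  classical
  refine le_fd_of_forall_le_playScore hc (cyclingExplorer_valid G) fun DS hDS => ?_
  refine ((isClosedSet_setOf_frequently G hDS v).graphDiam_lt_ncard ⟨hc, ha⟩).trans ?_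
  refine Set.ncard_le_ncard (fun u hu => ?_) (Set.toFinite _)
  obtain ⟨n, rfl⟩ := Filter.Frequently.exists hu
  exact ⟨n, by rw [play_eq_position_cons]; exact List.mem_cons_self⟩
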